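/- arXiv:2510.04065 — 2 statements merged into one kernel-verified Lean document; each statement's English description precedes it below -/
import Mathlib

section
/- Algebraic inequality for exponents above p−1: Let p ∈ (1,∞) and ε > p−1. Then there exist constants c₁ = c₁(p,ε) > 0 and c₂ = c₂(p,ε) > 0 such that for all a, b > 0 and all τ₁, τ₂ ∈ [0,1], J_p(b − a) ( τ₁^p a^{−ε} − τ₂^p b^{−ε} ) ≥ c₁ | τ₂ b^{(p−1−ε)/p} − τ₁ a^{(p−1−ε)/p} |^p − c₂ |τ₂ − τ₁|^p ( b^{p−1−ε} + a^{p−1−ε} ). -/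
open MeasureTheory Real Set Metric
open scoped RealInnerProductSpace ENNReal Topology NNReal

noncomputable section

/-- `J_p(t) = |t|^{p-2} t`. -/
def Jp (p t : ℝ) : ℝ := |t| ^ (p - 2) * t

theorem Jp_of_nonneg {p t : ℝ} (hp : 1 < p) (ht : 0 ≤ t) : Jp p t = t ^ (p - 1) := by
  rcases ht.eq_or_lt with rfl | ht
  · simp [Jp, Real.zero_rpow (by linarith : p - 1 ≠ 0)]
  · rw [Jp, abs_of_pos ht, show p - 1 = (p - 2) + 1 by ring, Real.rpow_add_one ht.ne']

theorem Jp_neg (p t : ℝ) : Jp p (-t) = -Jp p t := by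
  simp [Jp]

/-- Convexity of `t ↦ t ^ p` with weights `a / b` and `(b - a) / b`. -/
theorem sub_rpow_mul_add_rpow_le {p a b x y : ℝ} (hp : 1 < p) (ha : 0 < a) (hab : a ≤ b)
    (hx : 0 ≤ x) (hy : 0 ≤ y) :
    (b - a) ^ (p - 1) * (x + y) ^ p ≤
      (b - a) ^ (p - 1) * (b ^ (p - 1) / a ^ (p - 1)) * x ^ p + b ^ (p - 1) * y ^ p := by
  have hb : 0 < b := ha.trans_le hab
  rcases hab.eq_or_lt with rfl | hlt
  · rw [sub_self, Real.zero_rpow (by linarith : p - 1 ≠ 0)]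
    simp only [zero_mul, zero_add]
    positivity
  have hd : 0 < b - a := sub_pos.2 hlt
  have key := (convexOn_rpow hp.le).2
    (Set.mem_Ici.2 (by positivity : 0 ≤ b / a * x))
    (Set.mem_Ici.2 (by positivity : 0 ≤ b / (b - a) * y))
    (by positivity : 0 ≤ a / b) (by positivity : 0 ≤ (b - a) / b) (by field_simp; ring)
  simp only [smul_eq_mul] at key
  have e : a / b * (b / a * x) + (b - a) / b * (b / (b - a) * y) = x + y := by
    field_simp
  have hpow : ∀ {c : ℝ}, 0 < c → c ^ p = c ^ (p - 1) * c := fun {c} hc => by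
    rw [← Real.rpow_add_one hc.ne', sub_add_cancel]
  rw [e, Real.mul_rpow (by positivity) hx, Real.mul_rpow (by positivity) hy,
    Real.div_rpow hb.le ha.le, Real.div_rpow hb.le hd.le, hpow ha, hpow hb, hpow hd] at key
  calc (b - a) ^ (p - 1) * (x + y) ^ p ≤ _ := mul_le_mul_of_nonneg_left key (by positivity)
    _ = _ := by field_simp

theorem rpow_neg_sub_rpow_neg_le {γ a b : ℝ} (hγ : 0 < γ) (ha : 0 < a) (hab : a ≤ b) :
    a ^ (-γ) - b ^ (-γ) ≤ a ^ (-γ) * (γ * ((b - a) / a)) := by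
  have hb : 0 < b := ha.trans_le hab
  have h1 : b ^ (-γ) = a ^ (-γ) * (b / a) ^ (-γ) := by
    rw [← Real.mul_rpow ha.le (by positivity), mul_div_cancel₀ _ ha.ne']
  have h2 : 1 - γ * ((b - a) / a) ≤ (b / a) ^ (-γ) := by
    have hl : Real.log (b / a) ≤ b / a - 1 := Real.log_le_sub_one_of_pos (by positivity)
    have he := Real.add_one_le_exp (Real.log (b / a) * -γ)
    rw [Real.rpow_def_of_pos (by positivity)]
    have : (b - a) / a = b / a - 1 := by field_simp
    rw [this]
    nlinarith
  rw [h1]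
  nlinarith [Real.rpow_pos_of_pos ha (-γ)]

theorem rpow_neg_sub_rpow_neg_rpow_le {p γ a b : ℝ} (hp : 1 < p) (hγ : 0 < γ) (ha : 0 < a)
    (hab : a ≤ b) :
    (a ^ (-γ) - b ^ (-γ)) ^ p ≤
      γ ^ (p - 1) * ((b - a) ^ (p - 1) / a ^ (p - 1) * ((a ^ (-γ)) ^ p - (b ^ (-γ)) ^ p)) := by
  have hb : 0 < b := ha.trans_le hab
  have hle := rpow_neg_sub_rpow_neg_le hγ ha hab
  have hBA : b ^ (-γ) ≤ a ^ (-γ) := Real.rpow_le_rpow_of_nonpos ha hab (by linarith)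
  have hA : 0 < a ^ (-γ) := Real.rpow_pos_of_pos ha _
  have hB : 0 < b ^ (-γ) := Real.rpow_pos_of_pos hb _
  generalize a ^ (-γ) = A at *
  generalize b ^ (-γ) = B at *
  have hd : 0 ≤ b - a := sub_nonneg.2 hab
  have hpow : ∀ {c : ℝ}, 0 ≤ c → c ^ p = c ^ (p - 1) * c := fun {c} hc => by
    rw [← Real.rpow_add_one' hc (by linarith), sub_add_cancel]
  have h1 : (A - B) ^ (p - 1) ≤ A ^ (p - 1) * (γ ^ (p - 1) * ((b - a) ^ (p - 1) / a ^ (p - 1))) := by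
    rw [← Real.div_rpow hd ha.le, ← Real.mul_rpow hγ.le (by positivity),
      ← Real.mul_rpow hA.le (by positivity)]
    exact Real.rpow_le_rpow (sub_nonneg.2 hBA) hle (by linarith)
  have h2 : A ^ (p - 1) * (A - B) ≤ A ^ p - B ^ p := by
    rw [hpow hA.le, hpow hB.le]
    have := Real.rpow_le_rpow hB.le hBA (by linarith : 0 ≤ p - 1)
    nlinarith
  calc (A - B) ^ p = (A - B) ^ (p - 1) * (A - B) := hpow (sub_nonneg.2 hBA)
    _ ≤ A ^ (p - 1) * (γ ^ (p - 1) * ((b - a) ^ (p - 1) / a ^ (p - 1))) * (A - B) :=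
      mul_le_mul_of_nonneg_right h1 (sub_nonneg.2 hBA)
    _ = γ ^ (p - 1) * ((b - a) ^ (p - 1) / a ^ (p - 1)) * (A ^ (p - 1) * (A - B)) := by ring
    _ ≤ γ ^ (p - 1) * ((b - a) ^ (p - 1) / a ^ (p - 1)) * (A ^ p - B ^ p) :=
      mul_le_mul_of_nonneg_left h2 (by positivity)
    _ = _ := by ring

theorem abs_mul_sub_mul_rpow_le {p A B x y : ℝ} (hp : 1 ≤ p) (hB : 0 ≤ B) (hBA : B ≤ A)
    (hx : 0 ≤ x) :
    |y * B - x * A| ^ p ≤ 2 ^ (p - 1) * (|y - x| ^ p * B ^ p + x ^ p * (A - B) ^ p) := by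
  have hAB : 0 ≤ A - B := sub_nonneg.2 hBA
  have h1 : |y * B - x * A| ≤ |y - x| * B + x * (A - B) := by
    calc |y * B - x * A| = |(y - x) * B - x * (A - B)| := by ring_nf
      _ ≤ |(y - x) * B| + |x * (A - B)| := abs_sub _ _
      _ = _ := by rw [abs_mul, abs_of_nonneg hB, abs_of_nonneg (mul_nonneg hx hAB)]
  calc |y * B - x * A| ^ p ≤ (|y - x| * B + x * (A - B)) ^ p :=
        Real.rpow_le_rpow (abs_nonneg _) h1 (by linarith)
    _ ≤ 2 ^ (p - 1) * ((|y - x| * B) ^ p + (x * (A - B)) ^ p) :=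
        mod_cast NNReal.rpow_add_le_mul_rpow_add_rpow
          ⟨|y - x| * B, by positivity⟩ ⟨x * (A - B), by positivity⟩ hp
    _ = _ := by rw [Real.mul_rpow (abs_nonneg _) hB, Real.mul_rpow hx hAB]

theorem le_Jp_mul_of_le {p γ a b x y : ℝ} (hp : 1 < p) (hγ : 0 < γ) (ha : 0 < a) (hab : a ≤ b)
    (hx : 0 ≤ x) (hy : 0 ≤ y) :
    (2 ^ (p - 1) * γ ^ (p - 1))⁻¹ * |y * b ^ (-γ) - x * a ^ (-γ)| ^ p -
        (1 + (γ ^ (p - 1))⁻¹) * |y - x| ^ p * ((b ^ (-γ)) ^ p + (a ^ (-γ)) ^ p) ≤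
      Jp p (b - a) *
        (x ^ p * ((a ^ (-γ)) ^ p / a ^ (p - 1)) - y ^ p * ((b ^ (-γ)) ^ p / b ^ (p - 1))) := by
  have hb : 0 < b := ha.trans_le hab
  have hBA : b ^ (-γ) ≤ a ^ (-γ) := Real.rpow_le_rpow_of_nonpos ha hab (by linarith)
  have hA : 0 < a ^ (-γ) := Real.rpow_pos_of_pos ha _
  have hB : 0 < b ^ (-γ) := Real.rpow_pos_of_pos hb _
  have h1 := rpow_neg_sub_rpow_neg_rpow_le hp hγ ha hab
  have h2 := abs_mul_sub_mul_rpow_le (y := y) hp.le hB.le hBA hx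
  have h3 := sub_rpow_mul_add_rpow_le hp ha hab hx (abs_nonneg (y - x))
  have hd : 0 ≤ b - a := sub_nonneg.2 hab
  rw [Jp_of_nonneg hp hd]
  generalize a ^ (-γ) = A at *
  generalize b ^ (-γ) = B at *
  have hyp : y ^ p ≤ (x + |y - x|) ^ p :=
    Real.rpow_le_rpow hy (by linarith [le_abs_self (y - x)]) (by linarith)
  have hD : 0 ≤ (b - a) ^ (p - 1) := Real.rpow_nonneg hd _
  have h4 := (mul_le_mul_of_nonneg_left hyp hD).trans h3
  have hxp : 0 ≤ x ^ p := Real.rpow_nonneg hx _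
  have hΔ : 0 ≤ |y - x| ^ p := by positivity
  have hAp : 0 < A ^ p := Real.rpow_pos_of_pos hA _
  have hBp : 0 < B ^ p := Real.rpow_pos_of_pos hB _
  have ha' : 0 < a ^ (p - 1) := Real.rpow_pos_of_pos ha _
  have hb' : 0 < b ^ (p - 1) := Real.rpow_pos_of_pos hb _
  have hγ' : 0 < γ ^ (p - 1) := Real.rpow_pos_of_pos hγ _
  have h2' : (0 : ℝ) < 2 ^ (p - 1) := by positivity
  generalize (b - a) ^ (p - 1) = D at *
  generalize |y - x| ^ p = Δ at *
  generalize γ ^ (p - 1) = g at *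
  generalize (2 : ℝ) ^ (p - 1) = k at *
  generalize a ^ (p - 1) = a' at *
  generalize b ^ (p - 1) = b' at *
  have h5 : (k * g)⁻¹ * |y * B - x * A| ^ p ≤
      g⁻¹ * (Δ * B ^ p) + x ^ p * (D / a' * (A ^ p - B ^ p)) := by
    calc (k * g)⁻¹ * |y * B - x * A| ^ p
        ≤ (k * g)⁻¹ * (k * (Δ * B ^ p + x ^ p * (g * (D / a' * (A ^ p - B ^ p))))) := by
          refine mul_le_mul_of_nonneg_left (h2.trans ?_) (by positivity)
          gcongr
      _ = _ := by field_simp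
  have h6 : D * y ^ p * (B ^ p / b') ≤ x ^ p * (D / a' * B ^ p) + Δ * B ^ p := by
    calc D * y ^ p * (B ^ p / b') ≤ (D * (b' / a') * x ^ p + b' * Δ) * (B ^ p / b') :=
          mul_le_mul_of_nonneg_right h4 (by positivity)
      _ = _ := by field_simp
  have h7 : 0 ≤ (1 + g⁻¹) * Δ * A ^ p := by positivity
  have e : D * (x ^ p * (A ^ p / a') - y ^ p * (B ^ p / b')) =
      x ^ p * (D / a' * A ^ p) - D * y ^ p * (B ^ p / b') := by ring
  rw [e]
  linarith

/-- **Algebraic inequality for exponents above `p − 1`** (Lemma 2.8(a)). -/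
theorem algebraic_inequality_above
    (p ε : ℝ) (hp1 : 1 < p) (hε : p - 1 < ε) :
    ∃ c₁ c₂ : ℝ, 0 < c₁ ∧ 0 < c₂ ∧
      ∀ a b τ₁ τ₂ : ℝ, 0 < a → 0 < b →
        0 ≤ τ₁ → τ₁ ≤ 1 → 0 ≤ τ₂ → τ₂ ≤ 1 →
        c₁ * |τ₂ * b ^ ((p - 1 - ε) / p) - τ₁ * a ^ ((p - 1 - ε) / p)| ^ p -
            c₂ * |τ₂ - τ₁| ^ p * (b ^ (p - 1 - ε) + a ^ (p - 1 - ε)) ≤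
          Jp p (b - a) * (τ₁ ^ p * a ^ (-ε) - τ₂ ^ p * b ^ (-ε)) := by
  have hp0 : 0 < p := by linarith
  obtain ⟨γ, hγ⟩ : ∃ γ, γ = -((p - 1 - ε) / p) := ⟨_, rfl⟩
  have hγ0 : 0 < γ := by
    rw [hγ, ← neg_div]
    exact div_pos (by linarith) hp0
  have e1 : (p - 1 - ε) / p = -γ := by rw [hγ, neg_neg]
  have e2 : p - 1 - ε = -γ * p := by rw [← e1, div_mul_cancel₀ _ hp0.ne']
  have e3 : ∀ {c : ℝ}, 0 < c → c ^ (p - 1 - ε) = (c ^ (-γ)) ^ p := fun {c} hc => by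
    rw [e2, Real.rpow_mul hc.le]
  have e4 : ∀ {c : ℝ}, 0 < c → c ^ (-ε) = (c ^ (-γ)) ^ p / c ^ (p - 1) := fun {c} hc => by
    rw [← e3 hc, ← Real.rpow_sub hc]
    ring_nf
  refine ⟨(2 ^ (p - 1) * γ ^ (p - 1))⁻¹, 1 + (γ ^ (p - 1))⁻¹, by positivity, by positivity, ?_⟩
  intro a b τ₁ τ₂ ha hb h1 _ h2 _
  rw [e1, e3 ha, e3 hb, e4 ha, e4 hb]
  rcases le_total a b with hab | hab
  · exact le_Jp_mul_of_le hp1 hγ0 ha hab h1 h2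
  · have h := le_Jp_mul_of_le hp1 hγ0 hb hab h2 h1
    rw [← neg_sub b a, Jp_neg, abs_sub_comm (τ₁ * _), abs_sub_comm τ₁] at h
    linarith

end
end

section
/- Weighted Poincaré inequality: Let 1 < p < ∞, x₀ ∈ ℝⁿ and r > 0, and let φ : B_r(x₀) → [0,∞) be radially decreasing (i.e., φ(x) = g(|x − x₀|) for some nonincreasing g) with φ ≡ 1 in B_{r/2}(x₀). Then there exists a constant C = C(n,p) > 0, independent of r, x₀, φ and u, such that for every continuously differentiable u : B_r(x₀) → ℝ, ∫_{B_r(x₀)} | u − (u)_{φ,B_r(x₀)} |^p φ dx ≤ C r^p ∫_{B_r(x₀)} |∇u|^p φ dx, where (u)_{φ,B_r(x₀)} = ( ∫_{B_r(x₀)} u φ dx ) / ( ∫_{B_r(x₀)} φ dx ). -/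
open MeasureTheory Real Set Metric
open scoped RealInnerProductSpace ENNReal Topology NNReal

noncomputable section

abbrev En (n : ℕ) := EuclideanSpace ℝ (Fin n)

theorem abs_average_rpow_le {α : Type*} [MeasurableSpace α] {μ : Measure α} [IsFiniteMeasure μ]
    [NeZero μ] {p : ℝ} (hp : 1 ≤ p) {f : α → ℝ} (hf : Integrable f μ)
    (hfp : Integrable (fun x => |f x| ^ p) μ) :
    |⨍ x, f x ∂μ| ^ p ≤ ⨍ x, |f x| ^ p ∂μ := by
  have h1 : |⨍ x, f x ∂μ| ≤ ⨍ x, |f x| ∂μ := by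
    simpa only [average, Real.norm_eq_abs] using norm_integral_le_integral_norm f
  refine (Real.rpow_le_rpow (abs_nonneg _) h1 (by linarith)).trans ?_
  exact (convexOn_rpow hp).map_average_le
    (continuousOn_id.rpow_const fun _ _ => Or.inr (by linarith)) isClosed_Ici
    (ae_of_all _ fun x => abs_nonneg (f x)) hf.abs hfp

theorem ofReal_abs_average_rpow_le {α : Type*} [MeasurableSpace α] {μ : Measure α}
    [IsFiniteMeasure μ] [NeZero μ] {p : ℝ} (hp : 1 ≤ p) {f : α → ℝ} (hf : Integrable f μ)
    (hfp : Integrable (fun x => |f x| ^ p) μ) :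
    ENNReal.ofReal (|⨍ x, f x ∂μ| ^ p) ≤
      (μ univ)⁻¹ * ∫⁻ x, ENNReal.ofReal (|f x| ^ p) ∂μ := by
  refine (ENNReal.ofReal_le_ofReal (abs_average_rpow_le hp hf hfp)).trans ?_
  rw [average_eq, smul_eq_mul, ENNReal.ofReal_mul (by positivity),
    ofReal_integral_eq_lintegral_ofReal hfp (ae_of_all _ fun x => by positivity),
    ← ENNReal.ofReal_toReal (ENNReal.inv_ne_top.2 (NeZero.ne (μ univ))), ENNReal.toReal_inv]
  rfl

section Segment

variable {E : Type*} [NormedAddCommGroup E] [InnerProductSpace ℝ E] [CompleteSpace E]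

theorem continuous_gradient {u : E → ℝ} (hu : ContDiff ℝ 1 u) : Continuous (gradient u) :=
  (InnerProductSpace.toDual ℝ E).symm.continuous.comp (hu.continuous_fderiv one_ne_zero)

theorem ofReal_abs_sub_rpow_le_lintegral_gradient {u : E → ℝ} (hu : ContDiff ℝ 1 u) {p : ℝ}
    (hp : 1 ≤ p) (x y : E) :
    ENNReal.ofReal (|u x - u y| ^ p) ≤ ENNReal.ofReal (‖x - y‖ ^ p) *
      ∫⁻ t in Ioc (0 : ℝ) 1, ENNReal.ofReal (‖gradient u ((1 - t) • x + t • y)‖ ^ p) := by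
  have hp0 : 0 ≤ p := by linarith
  set γ : ℝ → E := fun t => (1 - t) • x + t • y with hγ
  have hγc : Continuous γ := by fun_prop
  have hγd : ∀ t, HasDerivAt γ (y - x) t := fun t => by
    have := (((hasDerivAt_id t).const_sub 1).smul_const x).add ((hasDerivAt_id t).smul_const y)
    refine this.congr_deriv ?_
    simp only [neg_smul, one_smul]; abel
  have hd : ∀ t, HasDerivAt (u ∘ γ) (fderiv ℝ u (γ t) (y - x)) t := fun t =>
    ((hu.differentiable one_ne_zero (γ t)).hasFDerivAt).comp_hasDerivAt t (hγd t)
  have hdc : Continuous fun t => fderiv ℝ u (γ t) (y - x) :=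
    ((hu.continuous_fderiv one_ne_zero).comp hγc).clm_apply continuous_const
  have hftc : ∫ t in Ioc (0 : ℝ) 1, fderiv ℝ u (γ t) (y - x) = u y - u x := by
    rw [← intervalIntegral.integral_of_le zero_le_one,
      intervalIntegral.integral_eq_sub_of_hasDerivAt (fun t _ => hd t)
        (hdc.intervalIntegrable _ _)]
    simp [hγ]
  have hcint : ∀ f : ℝ → ℝ, Continuous f → IntegrableOn f (Ioc 0 1) := fun f hf =>
    (hf.integrableOn_Icc).mono_set Ioc_subset_Icc_self
  have hμ : (volume.restrict (Ioc (0 : ℝ) 1)) univ = 1 := by simp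
  have : IsProbabilityMeasure (volume.restrict (Ioc (0 : ℝ) 1)) := ⟨hμ⟩
  have hJ := ofReal_abs_average_rpow_le hp (hcint _ hdc)
    (hcint _ (hdc.abs.rpow_const fun _ => Or.inr hp0))
  rw [average_eq_integral, hftc, hμ, inv_one, one_mul, abs_sub_comm] at hJ
  refine hJ.trans ?_
  rw [← lintegral_const_mul' _ _ ENNReal.ofReal_ne_top]
  refine lintegral_mono fun t => ?_
  rw [← ENNReal.ofReal_mul (by positivity), ← Real.mul_rpow (by positivity) (by positivity)]
  refine ENNReal.ofReal_le_ofReal (Real.rpow_le_rpow (abs_nonneg _) ?_ hp0)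
  rw [← inner_gradient_left, mul_comm, norm_sub_rev x y]
  exact abs_real_inner_le_norm _ _

end Segment

section Haar

variable {E : Type*} [NormedAddCommGroup E] [NormedSpace ℝ E] [FiniteDimensional ℝ E]
  [MeasurableSpace E] [BorelSpace E] (μ : Measure E) [μ.IsAddHaarMeasure]

theorem lintegral_comp_smul_add {F : E → ℝ≥0∞} (hF : Measurable F) {s : ℝ} (hs : s ≠ 0) (v : E) :
    ∫⁻ x, F (s • x + v) ∂μ =
      ENNReal.ofReal |(s ^ Module.finrank ℝ E)⁻¹| * ∫⁻ x, F x ∂μ := by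
  have h := lintegral_map (μ := μ) (f := fun x => F (x + v)) (g := fun x => s • x)
    (by fun_prop) (by fun_prop)
  rw [← h, Measure.map_addHaar_smul μ hs, lintegral_smul_measure,
    lintegral_add_right_eq_self, smul_eq_mul]

theorem setLIntegral_comp_convexComb_le {F : E → ℝ≥0∞} (hF : Measurable F) {B : Set E}
    (hB : MeasurableSet B) (hc : Convex ℝ B) {t : ℝ} (ht0 : 0 ≤ t) (ht : t ≤ 1 / 2) {y : E}
    (hy : y ∈ B) :
    ∫⁻ x in B, F ((1 - t) • x + t • y) ∂μ ≤ 2 ^ Module.finrank ℝ E * ∫⁻ x in B, F x ∂μ := by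
  calc ∫⁻ x in B, F ((1 - t) • x + t • y) ∂μ
      = ∫⁻ x in B, B.indicator F ((1 - t) • x + t • y) ∂μ := by
        refine setLIntegral_congr_fun hB fun x hx => ?_
        rw [indicator_of_mem (hc hx hy (by linarith) ht0 (by ring))]
    _ ≤ ∫⁻ x, B.indicator F ((1 - t) • x + t • y) ∂μ := setLIntegral_le_lintegral _ _
    _ = ENNReal.ofReal |((1 - t) ^ Module.finrank ℝ E)⁻¹| * ∫⁻ x in B, F x ∂μ := by
        rw [lintegral_comp_smul_add μ (hF.indicator hB) (by linarith), lintegral_indicator hB]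
    _ ≤ _ := by
        gcongr
        have h0 : (0 : ℝ) < 1 - t := by linarith
        rw [abs_of_pos (by positivity), ← inv_pow, ENNReal.ofReal_pow (by positivity)]
        gcongr
        rw [← ENNReal.ofReal_ofNat]
        refine ENNReal.ofReal_le_ofReal ?_
        rw [inv_le_comm₀ h0 two_pos]
        linarith

theorem lintegral_lintegral_convexComb_le {F : E → ℝ≥0∞} (hF : Measurable F) {B : Set E}
    (hB : MeasurableSet B) (hc : Convex ℝ B) (hBfin : μ B ≠ ∞) {t : ℝ} (ht0 : 0 ≤ t)
    (ht1 : t ≤ 1) :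
    ∫⁻ x in B, ∫⁻ y in B, F ((1 - t) • x + t • y) ∂μ ∂μ ≤
      2 ^ Module.finrank ℝ E * μ B * ∫⁻ x in B, F x ∂μ := by
  have hfin : IsFiniteMeasure (μ.restrict B) := ⟨by simpa using hBfin.lt_top⟩
  have key : ∀ s : ℝ, 0 ≤ s → s ≤ 1 / 2 →
      ∫⁻ y in B, ∫⁻ x in B, F ((1 - s) • x + s • y) ∂μ ∂μ ≤
        2 ^ Module.finrank ℝ E * μ B * ∫⁻ x in B, F x ∂μ := fun s hs0 hs => by
    calc _ ≤ ∫⁻ _ in B, 2 ^ Module.finrank ℝ E * ∫⁻ x in B, F x ∂μ ∂μ :=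
          setLIntegral_mono' hB fun y hy =>
            setLIntegral_comp_convexComb_le μ hF hB hc hs0 hs hy
      _ = _ := by rw [setLIntegral_const]; ring
  rcases le_total t (1 / 2) with h | h
  · rw [lintegral_lintegral_swap (by fun_prop)]
    exact key t ht0 h
  · convert key (1 - t) (by linarith) (by linarith) using 6
    rw [sub_sub_cancel, add_comm]

end Haar

section Weighted

variable {E : Type*} [NormedAddCommGroup E] [InnerProductSpace ℝ E] [FiniteDimensional ℝ E]
  [MeasurableSpace E] [BorelSpace E]

theorem lintegral_lintegral_abs_sub_rpow_le (μ : Measure E) [μ.IsAddHaarMeasure] {B : Set E}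
    (hB : MeasurableSet B) (hBfin : μ B ≠ ∞) {d : ℝ} (hd : ∀ x ∈ B, ∀ y ∈ B, dist x y ≤ d)
    {w : E → ℝ} (hw : Measurable w) (hw1 : ∀ x ∈ B, w x ≤ 1)
    (hq : QuasiconcaveOn ℝ B w) {u : E → ℝ} (hu : ContDiff ℝ 1 u) {p : ℝ} (hp : 1 ≤ p) {ν : Measure E}
    (hν : ν = (μ.restrict B).withDensity fun x => ENNReal.ofReal (w x)) :
    ∫⁻ x, ∫⁻ y, ENNReal.ofReal (|u x - u y| ^ p) ∂ν ∂ν ≤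
      ENNReal.ofReal (d ^ p) * (2 ^ Module.finrank ℝ E * μ B) *
        ∫⁻ x, ENNReal.ofReal (‖gradient u x‖ ^ p) ∂ν := by
  have hfin : IsFiniteMeasure (μ.restrict B) := ⟨by simpa using hBfin.lt_top⟩
  have hsf : SFinite ν := hν ▸ inferInstance
  have hp0 : 0 ≤ p := by linarith
  have hc : Convex ℝ B := hq.convex
  have hWm : Measurable fun x => ENNReal.ofReal (w x) := hw.ennreal_ofReal
  have hGm : Measurable fun x => ENNReal.ofReal (‖gradient u x‖ ^ p) :=
    (((continuous_gradient hu).norm.rpow_const fun _ => Or.inr hp0).measurable).ennreal_ofReal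
  have hDm : Measurable fun z : E × E => ENNReal.ofReal (|u z.1 - u z.2| ^ p) := by
    have := hu.continuous
    have h : Continuous fun z : E × E => |u z.1 - u z.2| := by fun_prop
    exact ((h.rpow_const fun _ => Or.inr hp0).measurable).ennreal_ofReal
  set F : E → ℝ≥0∞ := fun x => ENNReal.ofReal (w x) * ENNReal.ofReal (‖gradient u x‖ ^ p) with hF
  have hFm : Measurable F := hWm.mul hGm
  have hpt : ∀ x ∈ B, ∀ y ∈ B,
      ENNReal.ofReal (w x) * (ENNReal.ofReal (w y) * ENNReal.ofReal (|u x - u y| ^ p)) ≤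
        ENNReal.ofReal (d ^ p) * ∫⁻ t in Ioc (0 : ℝ) 1, F ((1 - t) • x + t • y) := by
    intro x hx y hy
    have hxy : ENNReal.ofReal (‖x - y‖ ^ p) ≤ ENNReal.ofReal (d ^ p) :=
      ENNReal.ofReal_le_ofReal
        (Real.rpow_le_rpow (norm_nonneg _) (dist_eq_norm x y ▸ hd x hx y hy) hp0)
    have h1 : ∀ z ∈ B, ENNReal.ofReal (w z) ≤ 1 := fun z hz => by
      simpa using hw1 z hz
    have hmin : ENNReal.ofReal (w x) * ENNReal.ofReal (w y) ≤ ENNReal.ofReal (min (w x) (w y)) := by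
      rcases le_total (w x) (w y) with h | h
      · rw [min_eq_left h]; exact mul_le_of_le_one_right' (h1 y hy)
      · rw [min_eq_right h]; exact mul_le_of_le_one_left' (h1 x hx)
    calc _ = (ENNReal.ofReal (w x) * ENNReal.ofReal (w y)) * ENNReal.ofReal (|u x - u y| ^ p) := by
          ring
      _ ≤ ENNReal.ofReal (min (w x) (w y)) * (ENNReal.ofReal (d ^ p) *
          ∫⁻ t in Ioc (0 : ℝ) 1,
            ENNReal.ofReal (‖gradient u ((1 - t) • x + t • y)‖ ^ p)) := by
          gcongr
          exact (ofReal_abs_sub_rpow_le_lintegral_gradient hu hp x y).trans (by gcongr)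
      _ = ENNReal.ofReal (d ^ p) * ∫⁻ t in Ioc (0 : ℝ) 1, ENNReal.ofReal (min (w x) (w y)) *
            ENNReal.ofReal (‖gradient u ((1 - t) • x + t • y)‖ ^ p) := by
          rw [lintegral_const_mul' _ _ ENNReal.ofReal_ne_top]; ring
      _ ≤ _ := by
          gcongr ENNReal.ofReal (d ^ p) * ?_
          refine setLIntegral_mono' measurableSet_Ioc fun t ht => ?_
          simp only [hF]
          gcongr
          exact (hq (min (w x) (w y)) ⟨hx, min_le_left _ _⟩ ⟨hy, min_le_right _ _⟩
            (by linarith [ht.2]) ht.1.le (by ring)).2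
  have hin : ∀ x, ∫⁻ y, ENNReal.ofReal (|u x - u y| ^ p) ∂ν =
      ∫⁻ y in B, ENNReal.ofReal (w y) * ENNReal.ofReal (|u x - u y| ^ p) ∂μ := fun x => by
    rw [hν, lintegral_withDensity_eq_lintegral_mul _ hWm
      (show Measurable fun y => ENNReal.ofReal (|u x - u y| ^ p) from
        hDm.comp measurable_prodMk_left)]
    rfl
  have hgr : ∫⁻ x, ENNReal.ofReal (‖gradient u x‖ ^ p) ∂ν = ∫⁻ x in B, F x ∂μ := by
    rw [hν, lintegral_withDensity_eq_lintegral_mul _ hWm hGm]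
    rfl
  have hout : ∫⁻ x, ∫⁻ y, ENNReal.ofReal (|u x - u y| ^ p) ∂ν ∂ν =
      ∫⁻ x in B, ∫⁻ y in B, ENNReal.ofReal (w x) *
        (ENNReal.ofReal (w y) * ENNReal.ofReal (|u x - u y| ^ p)) ∂μ ∂μ := by
    conv_lhs => rw [hν]
    rw [lintegral_withDensity_eq_lintegral_mul _ hWm (hν ▸ hDm.lintegral_prod_right')]
    refine lintegral_congr fun x => ?_
    rw [lintegral_const_mul' _ _ ENNReal.ofReal_ne_top, ← hin, Pi.mul_apply, ← hν]
  rw [hout, hgr]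
  calc _ ≤ ∫⁻ x in B, ∫⁻ y in B, ENNReal.ofReal (d ^ p) *
        (∫⁻ t in Ioc (0 : ℝ) 1, F ((1 - t) • x + t • y)) ∂μ ∂μ :=
        setLIntegral_mono' hB fun x hx => setLIntegral_mono' hB fun y hy => hpt x hx y hy
    _ = ENNReal.ofReal (d ^ p) * ∫⁻ x in B, ∫⁻ y in B,
        (∫⁻ t in Ioc (0 : ℝ) 1, F ((1 - t) • x + t • y)) ∂μ ∂μ := by
        simp_rw [lintegral_const_mul' _ _ ENNReal.ofReal_ne_top]
    _ = ENNReal.ofReal (d ^ p) * ∫⁻ t in Ioc (0 : ℝ) 1, ∫⁻ x in B, ∫⁻ y in B,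
        F ((1 - t) • x + t • y) ∂μ ∂μ := by
        congr 1
        symm
        rw [lintegral_lintegral_swap (Measurable.aemeasurable ?_)]
        · refine lintegral_congr fun x => ?_
          rw [lintegral_lintegral_swap (by fun_prop)]
        · refine Measurable.lintegral_prod_right' (f := fun q : (ℝ × E) × E =>
            F ((1 - q.1.1) • q.1.2 + q.1.1 • q.2)) (by fun_prop)
    _ ≤ ENNReal.ofReal (d ^ p) * ∫⁻ _ in Ioc (0 : ℝ) 1,
        2 ^ Module.finrank ℝ E * μ B * ∫⁻ x in B, F x ∂μ := by
        gcongr ENNReal.ofReal (d ^ p) * ?_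
        exact setLIntegral_mono' measurableSet_Ioc fun t ht =>
          lintegral_lintegral_convexComb_le μ hFm hB hc hBfin ht.1.le ht.2
    _ = _ := by
        rw [setLIntegral_const]
        simp [mul_assoc]

end Weighted

/-- **Weighted Poincaré inequality** (Lemma 2.5). -/
theorem weighted_poincare
    (n : ℕ) (p : ℝ) (hp1 : 1 < p) :
    ∃ C : ℝ, 0 < C ∧
      ∀ (x₀ : En n) (r : ℝ) (φ : En n → ℝ) (u : En n → ℝ),
        0 < r →
        (∀ x ∈ ball x₀ r, 0 ≤ φ x) →
        (∃ g : ℝ → ℝ, Antitone g ∧ ∀ x ∈ ball x₀ r, φ x = g ‖x - x₀‖) →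
        (∀ x ∈ ball x₀ (r / 2), φ x = 1) →
        ContDiff ℝ 1 u →
        (∫ x in ball x₀ r,
            |u x - (∫ z in ball x₀ r, u z * φ z) / (∫ z in ball x₀ r, φ z)| ^ p * φ x) ≤
          C * r ^ p * ∫ x in ball x₀ r, ‖gradient u x‖ ^ p * φ x := by
  refine ⟨2 ^ p * 4 ^ n, by positivity, ?_⟩
  rintro x₀ r φ u hr hφ0 ⟨g, hg, hφg⟩ hφ1 hu
  have hp0 : 0 ≤ p := by linarith
  set B := ball x₀ r with hB
  set w : En n → ℝ := fun x => g ‖x - x₀‖ with hwdef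
  have hBm : MeasurableSet B := measurableSet_ball
  have hBfin : volume B ≠ ∞ := measure_ball_lt_top.ne
  have hw : Measurable w := hg.measurable.comp (by fun_prop)
  have hw0 : ∀ x ∈ B, 0 ≤ w x := fun x hx => (hφ0 x hx).trans_eq (hφg x hx)
  have hsub : ball x₀ (r / 2) ⊆ B := ball_subset_ball (by linarith)
  have hw1 : ∀ x ∈ ball x₀ (r / 2), w x = 1 := fun x hx => by
    rw [← hφ1 x hx, hφg x (hsub hx)]
  have hwle : ∀ x ∈ B, w x ≤ 1 := fun x _ => by
    rw [← hw1 x₀ (mem_ball_self (by linarith))]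
    exact hg (by simp)
  have hq : QuasiconcaveOn ℝ B w := by
    have h : QuasiconvexOn ℝ B fun x : En n => ‖x - x₀‖ := by
      simpa only [dist_eq_norm] using (convexOn_dist x₀ (convex_ball x₀ r)).quasiconvexOn
    exact h.antitone_comp hg
  set ν := (volume.restrict B).withDensity fun x => ENNReal.ofReal (w x) with hν
  have hνle : ν ≤ volume.restrict B := by
    conv_rhs => rw [← withDensity_one (μ := volume.restrict B)]
    refine withDensity_mono ((ae_restrict_iff' hBm).2 (ae_of_all _ fun x hx => ?_))
    simpa using hwle x hx
  have hfinB : IsFiniteMeasure (volume.restrict B) := ⟨by simpa using hBfin.lt_top⟩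
  have hfin : IsFiniteMeasure ν := isFiniteMeasure_of_le _ hνle
  have hcint : ∀ f : En n → ℝ, Continuous f → Integrable f ν := fun f hf =>
    (((hf.continuousOn).integrableOn_compact (isCompact_closedBall x₀ r)).mono_set
      ball_subset_closedBall).integrable.mono_measure hνle
  have hνint : ∀ f : En n → ℝ, ∫ x in B, f x * φ x = ∫ x, f x ∂ν := fun f => by
    rw [hν, integral_withDensity_eq_integral_toReal_smul hw.ennreal_ofReal (by simp)]
    refine setIntegral_congr_fun hBm fun x hx => ?_
    simp only [smul_eq_mul]
    rw [ENNReal.toReal_ofReal (hw0 x hx), hφg x hx, mul_comm]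
  have hball : volume B = 2 ^ n * volume (ball x₀ (r / 2)) := by
    have h := Measure.addHaar_ball_mul_of_pos (volume : Measure (En n)) x₀ two_pos (r / 2)
    rw [mul_div_cancel₀ _ two_ne_zero, finrank_euclideanSpace_fin] at h
    rw [hB, h, Measure.addHaar_ball_center _ x₀, ENNReal.ofReal_pow two_pos.le, ENNReal.ofReal_ofNat]
  have hνlow : volume (ball x₀ (r / 2)) ≤ ν univ := by
    refine le_trans ?_ (measure_mono (subset_univ (ball x₀ (r / 2))))
    rw [hν, withDensity_apply _ measurableSet_ball,
      Measure.restrict_restrict measurableSet_ball, inter_eq_left.2 hsub,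
      setLIntegral_congr_fun (g := fun _ => 1) measurableSet_ball fun x hx => by simp [hw1 x hx]]
    simp
  have hpos : volume (ball x₀ (r / 2)) ≠ 0 := (measure_ball_pos _ _ (by linarith)).ne'
  have : NeZero ν := ⟨fun h => hpos (le_antisymm (by simpa [h] using hνlow) zero_le)⟩
  have hφint : ∫ z in B, φ z = ν.real univ := by
    simpa using hνint fun _ => 1
  have hmean : (∫ z in B, u z * φ z) / (∫ z in B, φ z) = ⨍ z, u z ∂ν := by
    rw [hνint, hφint, average_eq, smul_eq_mul, div_eq_inv_mul]
  rw [hmean, hνint fun x => |u x - ⨍ z, u z ∂ν| ^ p, hνint fun x => ‖gradient u x‖ ^ p]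
  have huc := hu.continuous
  have hcp : ∀ c : ℝ, Continuous fun x => |c - u x| ^ p := fun c =>
    (continuous_const.sub huc).abs.rpow_const fun _ => Or.inr hp0
  have hJ : ∀ x, ENNReal.ofReal (|u x - ⨍ z, u z ∂ν| ^ p) ≤
      (ν univ)⁻¹ * ∫⁻ y, ENNReal.ofReal (|u x - u y| ^ p) ∂ν := fun x => by
    have h : u x - ⨍ z, u z ∂ν = ⨍ z, (u x - u z) ∂ν := by
      have h0 : ν.real univ ≠ 0 := measureReal_univ_ne_zero
      rw [average_eq, average_eq, integral_sub (integrable_const _) (hcint u huc)]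
      simp only [integral_const, smul_eq_mul]
      field_simp
    rw [h]
    exact ofReal_abs_average_rpow_le hp1.le (hcint _ (continuous_const.sub huc)) (hcint _ (hcp _))
  have hD := lintegral_lintegral_abs_sub_rpow_le volume hBm hBfin (d := 2 * r)
    (fun x hx y hy => by linarith [dist_triangle_right x y x₀, mem_ball.1 hx, mem_ball.1 hy])
    hw hwle hq hu hp1.le hν
  have hGint : Integrable (fun x => ‖gradient u x‖ ^ p) ν :=
    hcint _ ((continuous_gradient hu).norm.rpow_const fun _ => Or.inr hp0)
  have hLint : Integrable (fun x => |u x - ⨍ z, u z ∂ν| ^ p) ν :=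
    hcint _ ((huc.sub continuous_const).abs.rpow_const fun _ => Or.inr hp0)
  have hconst : (ν univ)⁻¹ * (2 ^ n * volume B) ≤ 4 ^ n := by
    calc (ν univ)⁻¹ * (2 ^ n * volume B)
        ≤ (volume (ball x₀ (r / 2)))⁻¹ * (2 ^ n * (2 ^ n * volume (ball x₀ (r / 2)))) := by
          rw [hball]; gcongr
      _ = (2 * 2) ^ n * ((volume (ball x₀ (r / 2)))⁻¹ * volume (ball x₀ (r / 2))) := by
          rw [mul_pow]; ring
      _ = 4 ^ n := by
          rw [ENNReal.inv_mul_cancel hpos measure_ball_lt_top.ne, mul_one]; norm_num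
  rw [← ENNReal.ofReal_le_ofReal_iff (by positivity),
    ofReal_integral_eq_lintegral_ofReal hLint (ae_of_all _ fun x => by positivity),
    ENNReal.ofReal_mul (by positivity),
    ofReal_integral_eq_lintegral_ofReal hGint (ae_of_all _ fun x => by positivity)]
  rw [finrank_euclideanSpace_fin] at hD
  calc _ ≤ ∫⁻ x, (ν univ)⁻¹ * ∫⁻ y, ENNReal.ofReal (|u x - u y| ^ p) ∂ν ∂ν := lintegral_mono hJ
    _ = (ν univ)⁻¹ * ∫⁻ x, ∫⁻ y, ENNReal.ofReal (|u x - u y| ^ p) ∂ν ∂ν :=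
        lintegral_const_mul' _ _ (ENNReal.inv_ne_top.2 (NeZero.ne _))
    _ ≤ (ν univ)⁻¹ * (ENNReal.ofReal ((2 * r) ^ p) * (2 ^ n * volume B) *
        ∫⁻ x, ENNReal.ofReal (‖gradient u x‖ ^ p) ∂ν) := by gcongr
    _ = ENNReal.ofReal ((2 * r) ^ p) * ((ν univ)⁻¹ * (2 ^ n * volume B)) *
        ∫⁻ x, ENNReal.ofReal (‖gradient u x‖ ^ p) ∂ν := by ring
    _ ≤ ENNReal.ofReal ((2 * r) ^ p) * 4 ^ n *
        ∫⁻ x, ENNReal.ofReal (‖gradient u x‖ ^ p) ∂ν := by gcongr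
    _ = _ := by
        rw [Real.mul_rpow two_pos.le hr.le, mul_right_comm (2 ^ p), ENNReal.ofReal_mul (p := 2 ^ p * r ^ p) (by positivity),
          ENNReal.ofReal_pow (by norm_num), ENNReal.ofReal_ofNat]

end
end
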